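/- Let G be the simple group of order 168 and let S₄,(1), …, S₄,(7) be the seven conjugates in G of the subgroup S₄,(1) = ⟨(2,6,4)(3,5,8), (1,5)(2,8)(3,6)(4,7)⟩ (each isomorphic to the symmetric group S₄). For each i let η_i be the unique non-trivial degree-1 character of S₄,(i) (the sign character), and set e_{η_i} = (1/24) Σ_{h∈S₄,(i)} η_i(h)h ∈ ℚ[G]. Let e₅^G be the central idempotent attached to the irreducible character χ₅^G of G of degree 7. Then: (a) e₅^G = Σ_{i=1}^{7} e_{η_i}, and (b) e_{η_i} e_{η_j} = δ_{ij} e_{η_i} for all i, j. -/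

import Mathlib

open scoped Classical

/-- The idempotent `e_ψ^H = (1/|H|) ∑_{h∈H} ψ(h⁻¹) h` in the group algebra `K[G]`. -/
noncomputable def subIdem {G : Type} [Group G] [Fintype G] {K : Type} [Field K]
    (H : Subgroup G) (ψ : H → K) : MonoidAlgebra K G :=
  (Fintype.card H : K)⁻¹ • ∑ h : H, MonoidAlgebra.single (h : G) (ψ h⁻¹)

/-- The central idempotent `e_χ^G = (χ(1)/|G|) ∑_{g∈G} χ(g⁻¹) g`. -/
noncomputable def cenIdem {G : Type} [Group G] [Fintype G] {K : Type} [Field K]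
    (χ : G → K) (d : K) : MonoidAlgebra K G :=
  (d / (Fintype.card G : K)) • ∑ g : G, MonoidAlgebra.single g (χ g⁻¹)

/-- The conjugate subgroup `g H g⁻¹`. -/
def conjSub {G : Type} [Group G] (g : G) (H : Subgroup G) : Subgroup G :=
  Subgroup.map (MulAut.conj g).toMonoidHom H


/-- the `i`-th hexadecimal digit -/
def dig (a i : ℕ) : ℕ := a / 16 ^ i % 16

/-- composition of coded permutations -/
def mulc (a b : ℕ) : ℕ :=
  dig a (dig b 0) + 16 * (dig a (dig b 1) + 16 * (dig a (dig b 2) + 16 * (dig a (dig b 3) +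
  16 * (dig a (dig b 4) + 16 * (dig a (dig b 5) + 16 * (dig a (dig b 6) + 16 * (dig a (dig b 7) +
  16 * dig a (dig b 8))))))))

/-- code of a function -/
def encf (s : Fin 9 → Fin 9) : ℕ :=
  (s 0 : ℕ) + 16 * ((s 1 : ℕ) + 16 * ((s 2 : ℕ) + 16 * ((s 3 : ℕ) +
  16 * ((s 4 : ℕ) + 16 * ((s 5 : ℕ) + 16 * ((s 6 : ℕ) + 16 * ((s 7 : ℕ) +
  16 * (s 8 : ℕ))))))))

/-- code of a permutation -/
def enc (s : Equiv.Perm (Fin 9)) : ℕ := encf s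

lemma dig_encf_aux (s : Fin 9 → Fin 9) :
    dig (encf s) 0 = s 0 ∧ dig (encf s) 1 = s 1 ∧ dig (encf s) 2 = s 2 ∧ dig (encf s) 3 = s 3 ∧
    dig (encf s) 4 = s 4 ∧ dig (encf s) 5 = s 5 ∧ dig (encf s) 6 = s 6 ∧ dig (encf s) 7 = s 7 ∧
    dig (encf s) 8 = s 8 := by
  have h0 := (s 0).isLt
  have h1 := (s 1).isLt
  have h2 := (s 2).isLt
  have h3 := (s 3).isLt
  have h4 := (s 4).isLt
  have h5 := (s 5).isLt
  have h6 := (s 6).isLt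
  have h7 := (s 7).isLt
  have h8 := (s 8).isLt
  unfold dig encf
  refine ⟨?_, ?_, ?_, ?_, ?_, ?_, ?_, ?_, ?_⟩ <;> norm_num only <;> omega

lemma dig_encf (s : Fin 9 → Fin 9) (i : Fin 9) : dig (encf s) i = s i := by
  obtain ⟨h0, h1, h2, h3, h4, h5, h6, h7, h8⟩ := dig_encf_aux s
  fin_cases i
  exacts [h0, h1, h2, h3, h4, h5, h6, h7, h8]

lemma enc_mul (s t : Equiv.Perm (Fin 9)) : enc (s * t) = mulc (enc s) (enc t) := by
  have h : ∀ i : Fin 9, dig (encf s) (t i : Fin 9) = ((s * t) i : Fin 9) := by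
    intro i
    rw [dig_encf]
    rfl
  obtain ⟨h0, h1, h2, h3, h4, h5, h6, h7, h8⟩ := dig_encf_aux t
  unfold mulc enc
  rw [h0, h1, h2, h3, h4, h5, h6, h7, h8]
  simp only [h]
  rfl

lemma enc_inj {s t : Equiv.Perm (Fin 9)} (h : enc s = enc t) : s = t := by
  ext i
  rw [← dig_encf s i, ← dig_encf t i]
  exact congrArg (fun n => dig n i) h

lemma enc_one : enc 1 = 36344967696 := by decide

/-- codes of the powers of the element `c` of order 7 -/
def cpL : List ℕ := [
   36344967696, 26899280256, 13544540256, 30406092336, 19366548336, 10222798656, 5240218656]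

/-- codes of the inverses of the powers of `c` -/
def cmL : List ℕ := [
   36344967696, 5240218656, 10222798656, 19366548336, 30406092336, 13544540256, 26899280256]

/-- codes of the even elements of `S 0` -/
def spL : List ℕ := [
   36344967696, 14839600656, 23391011856, 15054698016, 32282923296, 30909170016, 22305469536,
   23730402336, 35239580256, 31516143936, 35722261056, 14268073536]

/-- codes of the odd elements of `S 0` -/
def smL : List ℕ := [
   9715542096, 26963612496, 26392085376, 5509424976, 17840674176, 18926216496, 4886718336,
   10322516016, 5992105776, 17501283696, 8948762736, 26176988016]

/-- codes of all elements of `G` -/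
def allG : List ℕ := [
   36344967696, 14839600656, 9715542096, 23391011856, 26963612496, 26392085376, 5509424976,
   17840674176, 18926216496, 15054698016, 4886718336, 10322516016, 32282923296, 30909170016,
   22305469536, 5992105776, 23730402336, 35239580256, 31516143936, 35722261056, 14268073536,
   17501283696, 8948762736, 26176988016, 26899280256, 31178445696, 4957943376, 22572917376,
   13490358096, 13245884256, 35000882256, 8929117536, 9504560496, 31814992656, 34748052576,
   5169841776, 18831595536, 19081095216, 23494476336, 35250381936, 23140528656, 27687145776,
   18578765856, 27253752096, 31428469536, 10856314176, 6529951296, 15135479616, 13544540256,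
   17737209696, 34701734736, 22150590816, 30375371856, 32302568496, 26096206416, 6483633456,
   6230803776, 18091157376, 27985801776, 36273742656, 9416693376, 9803216496, 22652920176,
   27741327936, 22400090496, 13977933936, 10053240336, 14332405776, 18658768656, 5981304096,
   36061844256, 31727125536, 30406092336, 9000342576, 27954071376, 21846325296, 19350893136,
   18877612656, 15154176336, 35991467376, 35554157856, 10525086816, 14537802096, 26869053216,
   6310613856, 4938298176, 22069778496, 14049313056, 23422249056, 30737126976, 5711995776,
   31459645056, 10034050176, 35205367056, 26663356176, 18111357456, 19366548336, 6547526256,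
   14520165456, 23673849456, 10338201936, 9487016256, 31744669776, 26711520576, 26381661456,
   5491819056, 30893484096, 13562639376, 35535345456, 34684159776, 21865137696, 30688962576,
   22590985776, 17557836576, 35739866976, 18640700256, 5696340576, 27669046656, 14850024576,
   10542723456, 10222798656, 36023259456, 31008887376, 23211352896, 5208426576, 6262503456,
   18020333136, 14866203936, 13191509376, 34969182576, 19196614176, 30437360256, 26365482096,
   28040176656, 23692010256, 17539675776, 22035071856, 10794325776, 27131348016, 10007701296,
   35825918256, 14100338016, 31223984736, 5405767776, 5240218656, 26693883936, 19161907536,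
   22354073376, 36293387856, 35519690256, 10494559056, 31197635856, 32231343456, 26077509696,
   9772040976, 19385360736, 13277614656, 14568329856, 23120328576, 10825593696, 21880792896,
   6026318976, 14362632816, 5677528176, 27182372976, 30706599216, 17809436976, 34921072176]

/-- a subgroup of order 3 -/
def C3L : List ℕ := [
   36344967696, 14839600656, 23391011856]

/-- a subgroup of order 6 -/
def S3L : List ℕ := [
   36344967696, 14839600656, 23391011856, 17501283696, 8948762736, 26176988016]

/-- a subgroup of order 4 -/
def C4L : List ℕ := [
   36344967696, 26963612496, 32282923296, 18926216496]

/-- a subgroup of order 7 -/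
def C7L : List ℕ := [
   36344967696, 26899280256, 13544540256, 30406092336, 19366548336, 10222798656, 5240218656]

/-- a subgroup of order 21 -/
def F21L : List ℕ := [
   36344967696, 18111357456, 23140528656, 35205367056, 31197635856, 35519690256, 18831595536,
   26381661456, 14839600656, 14332405776, 10053240336, 18658768656, 23391011856, 30688962576,
   26663356176, 28040176656, 10794325776, 23692010256, 13562639376, 31814992656, 9772040976]

/-- class representatives -/
def repL : List ℕ := [
   36344967696, 9715542096, 14839600656, 26963612496, 26899280256]

/-- words for the elements of `S 0` -/
def wordsL : List (List Bool) := [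
   [],
   [false],
   [true],
   [false, false],
   [true, false],
   [false, true],
   [true, false, false],
   [false, true, false],
   [false, false, true],
   [true, false, true],
   [false, true, false, false],
   [false, false, true, false],
   [true, false, true, false],
   [true, false, false, true],
   [false, true, false, true],
   [false, false, true, false, false],
   [true, false, true, false, false],
   [true, false, false, true, false],
   [false, true, false, false, true],
   [false, false, true, false, true],
   [false, true, false, false, true, false],
   [true, false, true, false, false, true],
   [true, false, false, true, false, true],
   [true, false, true, false, false, true, false]]

/-- code of the identity -/
def idc : ℕ := 36344967696

/-- the sign function of `S 0` extended by zero -/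
def sgn0 (a : ℕ) : ℤ := if a ∈ spL then 1 else if a ∈ smL then -1 else 0

/-- evaluation of a word in the codes of `x`, `y` -/
def evalw : List Bool → ℕ
  | [] => idc
  | b :: w => mulc (if b then 9715542096 else 14839600656) (evalw w)

/-- class of an element, determined by its order -/
def cls (a : ℕ) : ℕ :=
  if a = idc then 0 else if mulc a a = idc then 1 else if mulc a (mulc a a) = idc then 2 else
  if mulc (mulc a a) (mulc a a) = idc then 3 else 4

/-- conjugate of a code by the `j`-th power of `c` -/
def cj (j : ℕ) (a : ℕ) : ℕ := mulc (cmL.getD j 0) (mulc a (cpL.getD j 0))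

/-- the value of the degree 7 character -/
def tval (k : ℕ) : ℤ := [7, -1, 1, -1, 0].getD k 0

/-- subgroup test -/
def isSub (L : List ℕ) : Bool :=
  L.contains idc && L.all fun a => allG.contains a && L.all fun b => L.contains (mulc a b)

lemma chk_nodup : allG.Nodup := by decide +kernel
lemma chk_left : (allG.all fun a => allG.contains (mulc 18111357456 a) &&
    allG.contains (mulc 10542723456 a)) = true := by decide +kernel
lemma chk_GL : allG = cpL.flatMap (fun c => wordsL.map fun w => mulc c (evalw w)) := by
  decide +kernel
lemma chk_words : (wordsL.all fun w => sgn0 (evalw w) == (-1) ^ w.count true) = true := by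
  decide +kernel
lemma chk_spm : ((spL ++ smL).all fun a => (wordsL.map evalw).contains a) = true := by
  decide +kernel
lemma chk_spm_left : ((spL ++ smL).all fun a => (spL ++ smL).contains (mulc 14839600656 a) &&
    (spL ++ smL).contains (mulc 9715542096 a)) = true := by decide +kernel
lemma chk_cls : (allG.all fun a => allG.any fun u =>
    mulc u a == mulc (repL.getD (cls a) 0) u || mulc (repL.getD (cls a) 0) (mulc u a) == u)
    = true := by decide +kernel
lemma chk_char : (allG.all fun a => ((List.range 7).map fun j => sgn0 (cj j a)).sum == tval (cls a))
    = true := by decide +kernel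
lemma chk_orth : ((List.range 7).all fun i => (List.range 7).all fun j => i == j || allG.any fun a =>
    sgn0 (cj i a) * sgn0 (cj j a) == -1) = true := by decide +kernel
lemma chk_C3 : isSub C3L = true := by decide +kernel
lemma chk_S3 : isSub S3L = true := by decide +kernel
lemma chk_A4 : isSub spL = true := by decide +kernel
lemma chk_S4 : isSub (spL ++ smL) = true := by decide +kernel
lemma chk_C4 : isSub C4L = true := by decide +kernel
lemma chk_C7 : isSub C7L = true := by decide +kernel
lemma chk_F21 : isSub F21L = true := by decide +kernel
lemma chk_cm : ((List.range 7).all fun j =>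
  mulc (cmL.getD j 0) (cpL.getD j 0) == idc && allG.contains (cpL.getD j 0)) = true := by
  decide +kernel
lemma chk_gen : ((spL ++ smL).all fun a => spL.any fun b => S3L.any fun d => a == mulc b d)
    = true := by decide +kernel
lemma enc_g1 : enc (c[(3 : Fin 9), 6, 7] * c[(4 : Fin 9), 5, 8]) = 18111357456 := by
  decide +kernel
lemma enc_g2 : enc (c[(1 : Fin 9), 8, 2] * c[(4 : Fin 9), 5, 6]) = 10542723456 := by
  decide +kernel
lemma enc_x : enc (c[(2 : Fin 9), 6, 4] * c[(3 : Fin 9), 5, 8]) = 14839600656 := by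
  decide +kernel
lemma enc_y : enc (c[(1 : Fin 9), 5] * c[(2 : Fin 9), 8] * c[(3 : Fin 9), 6] * c[(4 : Fin 9), 7])
    = 9715542096 := by
  decide +kernel

/-- the hypothesis that `G` is the explicit group -/
def IsG (G : Subgroup (Equiv.Perm (Fin 9))) : Prop :=
  (∀ g : G, enc g ∈ allG) ∧ ∀ a ∈ allG, ∃ g : G, enc g = a

lemma inv_eq_sq {s : Equiv.Perm (Fin 9)} {n : ℕ} (h : enc s = n)
    (h3 : mulc n (mulc n n) = idc) : s⁻¹ = s * s := by
  have : s * (s * s) = 1 := by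
    apply enc_inj
    rw [enc_mul, enc_mul, h, h3, enc_one]; rfl
  exact inv_eq_of_mul_eq_one_right this

lemma isG_mem {G : Subgroup (Equiv.Perm (Fin 9))} (hG : G = Subgroup.closure
      {c[(3 : Fin 9), 6, 7] * c[(4 : Fin 9), 5, 8], c[(1 : Fin 9), 8, 2] * c[(4 : Fin 9), 5, 6]})
    (g : G) : enc g ∈ allG := by
  obtain ⟨g, hg⟩ := g
  subst hG
  have hl := chk_left
  simp only [List.all_eq_true, Bool.and_eq_true, List.contains_iff_mem] at hl
  have key : ∀ s ∈ ({c[(3 : Fin 9), 6, 7] * c[(4 : Fin 9), 5, 8],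
      c[(1 : Fin 9), 8, 2] * c[(4 : Fin 9), 5, 6]} : Set (Equiv.Perm (Fin 9))),
      (∀ a ∈ allG, mulc (enc s) a ∈ allG) ∧ s⁻¹ = s * s := by
    intro s hs
    rcases hs with rfl | rfl
    · rw [enc_g1]
      exact ⟨fun a ha => (hl a ha).1, inv_eq_sq enc_g1 (by decide +kernel)⟩
    · rw [enc_g2]
      exact ⟨fun a ha => (hl a ha).2, inv_eq_sq enc_g2 (by decide +kernel)⟩
  show enc g ∈ allG
  induction hg using Subgroup.closure_induction_left with
  | one => rw [enc_one]; decide +kernel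
  | mul_left s hs y hy ih => rw [enc_mul]; exact (key s hs).1 _ ih
  | inv_mul_cancel s hs y hy ih =>
    rw [(key s hs).2, mul_assoc, enc_mul, enc_mul]
    exact (key s hs).1 _ ((key s hs).1 _ ih)

/-- evaluation of a word in `x`, `y` -/
def evalG {H : Type} [Group H] (x y : H) : List Bool → H
  | [] => 1
  | b :: w => (if b then y else x) * evalG x y w

lemma enc_evalG {G : Subgroup (Equiv.Perm (Fin 9))} {x y : G}
    (hx : enc x = 14839600656) (hy : enc y = 9715542096) (w : List Bool) :
    enc (evalG x y w : G) = evalw w := by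
  induction w with
  | nil => exact enc_one
  | cons b w ih =>
    rw [evalG, evalw, Subgroup.coe_mul, enc_mul, ih]
    cases b <;> simp [hx, hy]

lemma evalG_mem {H : Type} [Group H] (x y : H) (K : Subgroup H) (hx : x ∈ K) (hy : y ∈ K)
    (w : List Bool) : evalG x y w ∈ K := by
  induction w with
  | nil => exact K.one_mem
  | cons b w ih =>
    rw [evalG]
    refine K.mul_mem ?_ ih
    cases b <;> simp [hx, hy]

lemma enc_pow {s : Equiv.Perm (Fin 9)} (h : enc s = 26899280256) :
    ∀ c ∈ cpL, ∃ k : ℕ, enc (s ^ k) = c := by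
  have e0 : enc (s ^ 0) = cpL.getD 0 0 := by rw [pow_zero, enc_one]; decide
  have st : ∀ k < 6, enc (s ^ k) = cpL.getD k 0 → enc (s ^ (k + 1)) = cpL.getD (k + 1) 0 := by
    intro k hk hh
    have hd : ∀ k < 6, mulc (cpL.getD k 0) 26899280256 = cpL.getD (k + 1) 0 := by decide +kernel
    rw [pow_succ, enc_mul, hh, h, hd k hk]
  have all : ∀ k < 7, enc (s ^ k) = cpL.getD k 0 := by
    intro k
    induction k with
    | zero => intro _; exact e0
    | succ k ih => intro hk; exact st k (by omega) (ih (by omega))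
  intro c hc
  obtain ⟨k, hk, rfl⟩ := List.getElem_of_mem hc
  exact ⟨k, by rw [all k hk, List.getD_eq_getElem _ _ hk]⟩

lemma isG_of {G : Subgroup (Equiv.Perm (Fin 9))} (hG : G = Subgroup.closure
      {c[(3 : Fin 9), 6, 7] * c[(4 : Fin 9), 5, 8], c[(1 : Fin 9), 8, 2] * c[(4 : Fin 9), 5, 6]})
    {x y : G} (hx : enc x = 14839600656) (hy : enc y = 9715542096) : IsG G := by
  refine ⟨isG_mem hG, fun a ha => ?_⟩
  rw [chk_GL] at ha
  simp only [List.mem_flatMap, List.mem_map] at ha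
  obtain ⟨c, hc, w, hw, rfl⟩ := ha
  have h1 : c[(3 : Fin 9), 6, 7] * c[(4 : Fin 9), 5, 8] ∈ G := by
    rw [hG]; exact Subgroup.subset_closure (by simp)
  have h2 : c[(1 : Fin 9), 8, 2] * c[(4 : Fin 9), 5, 6] ∈ G := by
    rw [hG]; exact Subgroup.subset_closure (by simp)
  set s := c[(1 : Fin 9), 8, 2] * c[(4 : Fin 9), 5, 6] * ((c[(3 : Fin 9), 6, 7] *
    c[(4 : Fin 9), 5, 8]) * (c[(3 : Fin 9), 6, 7] * c[(4 : Fin 9), 5, 8])) with hs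
  have hsG : s ∈ G := G.mul_mem h2 (G.mul_mem h1 h1)
  have hse : enc s = 26899280256 := by
    rw [hs, enc_mul, enc_mul (c[(3 : Fin 9), 6, 7] * c[(4 : Fin 9), 5, 8]), enc_g1, enc_g2]
    decide +kernel
  obtain ⟨k, hk⟩ := enc_pow hse c hc
  refine ⟨⟨s, hsG⟩ ^ k * evalG x y w, ?_⟩
  rw [Subgroup.coe_mul, enc_mul, enc_evalG hx hy, Subgroup.coe_pow, hk]

lemma sgn0_ne_zero {a : ℕ} : sgn0 a ≠ 0 ↔ a ∈ spL ++ smL := by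
  unfold sgn0
  split_ifs <;> simp_all

lemma mem_S0 {G : Subgroup (Equiv.Perm (Fin 9))}
    {x y : G} (hx : enc x = 14839600656) (hy : enc y = 9715542096) (g : G) :
    g ∈ Subgroup.closure {x, y} ↔ sgn0 (enc g) ≠ 0 := by
  rw [sgn0_ne_zero]
  constructor
  · intro hg
    have hl := chk_spm_left
    simp only [List.all_eq_true, Bool.and_eq_true, List.contains_iff_mem] at hl
    have hxi : x⁻¹ = x * x := Subtype.ext (inv_eq_sq hx (by decide +kernel))
    have hyi : y⁻¹ = y := by
      refine inv_eq_of_mul_eq_one_right (Subtype.ext (enc_inj ?_))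
      rw [Subgroup.coe_mul, enc_mul, hy, Subgroup.coe_one, enc_one]
      decide +kernel
    have hX : ∀ z : G, enc z ∈ spL ++ smL → enc (x * z : G) ∈ spL ++ smL := by
      intro z hz
      rw [Subgroup.coe_mul, enc_mul, hx]
      exact (hl _ hz).1
    have hY : ∀ z : G, enc z ∈ spL ++ smL → enc (y * z : G) ∈ spL ++ smL := by
      intro z hz
      rw [Subgroup.coe_mul, enc_mul, hy]
      exact (hl _ hz).2
    induction hg using Subgroup.closure_induction_left with
    | one => rw [Subgroup.coe_one, enc_one]; decide +kernel
    | mul_left s hs z hz ih =>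
      rcases hs with rfl | rfl
      · exact hX _ ih
      · exact hY _ ih
    | inv_mul_cancel s hs z hz ih =>
      rcases hs with rfl | rfl
      · rw [hxi, mul_assoc]; exact hX _ (hX _ ih)
      · rw [hyi]; exact hY _ ih
  · intro hg
    have hw := chk_spm
    simp only [List.all_eq_true, List.contains_iff_mem, List.mem_map] at hw
    obtain ⟨w, _, hw⟩ := hw _ hg
    rw [← enc_evalG hx hy] at hw
    rw [← Subtype.ext (enc_inj hw)]
    exact evalG_mem _ _ _ (Subgroup.subset_closure (by simp)) (Subgroup.subset_closure (by simp)) _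

lemma cube_one {q : ℚ} (h : q * (q * q) = 1) : q = 1 := by
  have : (q - 1) * (q ^ 2 + q + 1) = 0 := by linear_combination h
  rcases mul_eq_zero.1 this with h | h
  · linarith
  · nlinarith [sq_nonneg (q + 1 / 2)]

lemma eta_S0 {G : Subgroup (Equiv.Perm (Fin 9))}
    {x y : G} (hx : enc x = 14839600656) (hy : enc y = 9715542096)
    {K : Subgroup G} (hK : K = Subgroup.closure {x, y})
    (η : K →* ℚ) (hη : η ≠ 1) (g : K) : η g = sgn0 (enc (g : G)) := by
  let X : K := ⟨x, by rw [hK]; exact Subgroup.subset_closure (by simp)⟩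
  let Y : K := ⟨y, by rw [hK]; exact Subgroup.subset_closure (by simp)⟩
  have coe_eval : ∀ w, ((evalG X Y w : K) : G) = evalG x y w := by
    intro w
    induction w with
    | nil => rfl
    | cons b w ih =>
      rw [evalG, evalG, Subgroup.coe_mul, ih]
      cases b <;> simp [X, Y]
  have hex : ∀ g : K, ∃ w ∈ wordsL, evalG X Y w = g := by
    intro g
    have hg := sgn0_ne_zero.1 ((mem_S0 hx hy g).1 (hK ▸ g.2))
    have hw := chk_spm
    simp only [List.all_eq_true, List.contains_iff_mem, List.mem_map] at hw
    obtain ⟨w, hw1, hw⟩ := hw _ hg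
    refine ⟨w, hw1, Subtype.ext (Subtype.ext (enc_inj ?_))⟩
    rw [coe_eval, enc_evalG hx hy, hw]
  have hX3 : X * (X * X) = 1 := by
    refine Subtype.ext (Subtype.ext (enc_inj ?_))
    show enc ((x : Equiv.Perm (Fin 9)) * (x * x)) = enc 1
    rw [enc_mul, enc_mul, hx, enc_one]
    decide +kernel
  have hY2 : Y * Y = 1 := by
    refine Subtype.ext (Subtype.ext (enc_inj ?_))
    show enc ((y : Equiv.Perm (Fin 9)) * y) = enc 1
    rw [enc_mul, hy, enc_one]
    decide +kernel
  have eX : η X = 1 := by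
    have h := congrArg η hX3
    rw [map_mul, map_mul, map_one] at h
    exact cube_one h
  have ev : ∀ w, η (evalG X Y w) = (η Y) ^ w.count true := by
    intro w
    induction w with
    | nil => simp [evalG]
    | cons b w ih =>
      rw [evalG, map_mul, ih]
      cases b
      · simp [eX]
      · simp [pow_succ, mul_comm]
  have eY : η Y = -1 := by
    have h := congrArg η hY2
    rw [map_mul, map_one] at h
    rcases mul_self_eq_one_iff.1 h with h | h
    · exfalso
      apply hη
      ext g
      obtain ⟨w, _, rfl⟩ := hex g
      rw [ev, h]; simp
    · exact h
  obtain ⟨w, hw, rfl⟩ := hex g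
  rw [ev, eY, coe_eval, enc_evalG hx hy]
  have hc := chk_words
  simp only [List.all_eq_true, beq_iff_eq] at hc
  rw [hc w hw]
  push_cast
  rfl

lemma chk_cm2 : ∀ j < 7, cmL.getD j 0 ∈ allG := by decide +kernel

lemma conj_eta {G : Subgroup (Equiv.Perm (Fin 9))}
    {x y : G} (hx : enc x = 14839600656) (hy : enc y = 9715542096)
    {K0 K : Subgroup G} (hK0 : K0 = Subgroup.closure {x, y}) (g : G) (hK : K = conjSub g K0)
    (η : K →* ℚ) (hη : η ≠ 1) :
    (∀ h : G, h ∈ K ↔ sgn0 (enc (g⁻¹ * h * g : G)) ≠ 0) ∧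
    ∀ h : K, η h = sgn0 (enc (g⁻¹ * h * g : G)) := by
  have mK : ∀ h : G, h ∈ K ↔ g⁻¹ * h * g ∈ K0 := by
    intro h
    rw [hK, conjSub, Subgroup.mem_map]
    constructor
    · rintro ⟨k, hk, rfl⟩
      simpa [mul_assoc] using hk
    · intro hh
      exact ⟨_, hh, by simp [mul_assoc]⟩
  refine ⟨fun h => by rw [mK, hK0, mem_S0 hx hy], ?_⟩
  let f : K0 →* K :=
    { toFun := fun k => ⟨g * k * g⁻¹, by rw [mK]; simp [mul_assoc]⟩
      map_one' := by simp
      map_mul' := by intro a b; ext; simp }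
  have hf : ∀ h : K, ∃ k : K0, f k = h ∧ (k : G) = g⁻¹ * h * g := by
    intro h
    refine ⟨⟨g⁻¹ * h * g, (mK h).1 h.2⟩, Subtype.ext ?_, rfl⟩
    simp [f, mul_assoc]
  have hne : η.comp f ≠ 1 := by
    intro h1
    apply hη
    ext h
    obtain ⟨k, rfl, _⟩ := hf h
    exact DFunLike.congr_fun h1 k
  intro h
  obtain ⟨k, hk, hk2⟩ := hf h
  have := eta_S0 hx hy hK0 (η.comp f) hne k
  rw [← hk2, ← this, ← hk]
  rfl

lemma enc_cj {G : Subgroup (Equiv.Perm (Fin 9))} (hG : IsG G) (j : ℕ) (hj : j < 7) (g h : G)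
    (hg : enc g = cpL.getD j 0) : enc (g⁻¹ * h * g : G) = cj j (enc h) := by
  obtain ⟨g', hg'⟩ := hG.2 _ (chk_cm2 j hj)
  have hc := chk_cm
  simp only [List.all_eq_true, List.mem_range, Bool.and_eq_true, beq_iff_eq] at hc
  have : g' * g = 1 := by
    refine Subtype.ext (enc_inj ?_)
    rw [Subgroup.coe_mul, enc_mul, hg, hg', (hc j hj).1, Subgroup.coe_one, enc_one]
    rfl
  rw [← eq_inv_of_mul_eq_one_left this, mul_assoc]
  simp only [Subgroup.coe_mul, enc_mul, hg, hg']
  rfl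

lemma exists_pi {G : Subgroup (Equiv.Perm (Fin 9))} (hG : IsG G)
    {x y : G} (hx : enc x = 14839600656) (hy : enc y = 9715542096)
    (S : Fin 7 → Subgroup G) (hS0 : S 0 = Subgroup.closure {x, y})
    (hScompl : ∀ T : Subgroup G, (∃ g : G, T = conjSub g (S 0)) → ∃ i, T = S i)
    (η : ∀ i, (S i : Subgroup G) →* ℚ) (hη : ∀ i, η i ≠ 1) :
    ∃ p : Fin 7 ≃ Fin 7, ∀ j : Fin 7, (∀ h : G, h ∈ S (p j) ↔ sgn0 (cj j (enc h)) ≠ 0) ∧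
      ∀ h : S (p j), η (p j) h = sgn0 (cj j (enc (h : G))) := by
  have hc := chk_cm
  simp only [List.all_eq_true, List.mem_range, Bool.and_eq_true, beq_iff_eq,
    List.contains_iff_mem] at hc
  have h1 : ∀ j : Fin 7, ∃ i : Fin 7, (∀ h : G, h ∈ S i ↔ sgn0 (cj j (enc h)) ≠ 0) ∧
      ∀ h : S i, η i h = sgn0 (cj j (enc (h : G))) := by
    intro j
    obtain ⟨g, hg⟩ := hG.2 _ (hc j j.2).2
    obtain ⟨i, hi⟩ := hScompl _ ⟨g, rfl⟩
    refine ⟨i, ?_⟩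
    have := conj_eta hx hy hS0 g hi.symm (η i) (hη i)
    simp only [enc_cj hG j j.2 g _ hg] at this
    exact this
  choose p hp using h1
  have inj : Function.Injective p := by
    intro i j hij
    by_contra hne
    have ho := chk_orth
    simp only [List.all_eq_true, List.mem_range, Bool.or_eq_true, beq_iff_eq,
      List.any_eq_true] at ho
    rcases ho i i.2 j j.2 with h | ⟨a, ha, h⟩
    · exact hne (Fin.ext h)
    obtain ⟨g, rfl⟩ := hG.2 a ha
    have hi := hp i
    have hj := hp j
    rw [← hij] at hj
    have hm : g ∈ S (p i) := by
      rw [hi.1]; intro h0; rw [h0] at h; simp at h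
    have e1 := hi.2 ⟨g, hm⟩
    have e2 := hj.2 ⟨g, hm⟩
    rw [e1] at e2
    have e3 : sgn0 (cj i (enc g)) = sgn0 (cj j (enc g)) := by exact_mod_cast e2
    rw [e3] at h
    generalize sgn0 (cj j (enc g)) = q at h
    nlinarith [mul_self_nonneg q]
  exact ⟨Equiv.ofBijective p (Finite.injective_iff_bijective.1 inj), hp⟩

lemma single_mul_subIdem {G : Type} [Group G] [Fintype G] (H : Subgroup G) (ψ : H →* ℚ) (h : H) :
    MonoidAlgebra.single (h : G) (1 : ℚ) * subIdem H ψ = ψ h • subIdem H ψ := by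
  unfold subIdem
  rw [mul_smul_comm, smul_comm (ψ h)]
  congr 1
  rw [Finset.mul_sum, Finset.smul_sum]
  refine Fintype.sum_equiv (Equiv.mulLeft h) _ _ fun k => ?_
  simp only [MonoidAlgebra.single_mul_single, one_mul, Equiv.coe_mulLeft, MonoidAlgebra.smul_single,
    smul_eq_mul, Subgroup.coe_mul]
  congr 1
  rw [mul_comm, ← map_mul]
  congr 1
  group

lemma subIdem_mul_single {G : Type} [Group G] [Fintype G] (H : Subgroup G) (ψ : H →* ℚ) (h : H) :
    subIdem H ψ * MonoidAlgebra.single (h : G) (1 : ℚ) = ψ h • subIdem H ψ := by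
  unfold subIdem
  rw [smul_mul_assoc, smul_comm (ψ h)]
  congr 1
  rw [Finset.sum_mul, Finset.smul_sum]
  refine Fintype.sum_equiv (Equiv.mulRight h) _ _ fun k => ?_
  simp only [MonoidAlgebra.single_mul_single, mul_one, Equiv.coe_mulRight,
    MonoidAlgebra.smul_single, smul_eq_mul, Subgroup.coe_mul]
  congr 1
  rw [← map_mul]
  congr 1
  group

lemma subIdem_idem {G : Type} [Group G] [Fintype G] (H : Subgroup G) (ψ : H →* ℚ) :
    subIdem H ψ * subIdem H ψ = subIdem H ψ := by
  have hs : ∀ h : H, MonoidAlgebra.single (h : G) (ψ h⁻¹) * subIdem H ψ = subIdem H ψ := by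
    intro h
    have : (MonoidAlgebra.single (h : G) (ψ h⁻¹) : MonoidAlgebra ℚ G) =
        ψ h⁻¹ • MonoidAlgebra.single (h : G) (1 : ℚ) := by
      rw [MonoidAlgebra.smul_single, smul_eq_mul, mul_one]
    rw [this, smul_mul_assoc, single_mul_subIdem, smul_smul, ← map_mul, inv_mul_cancel, map_one,
      one_smul]
  conv_lhs => enter [1]; rw [subIdem]
  rw [smul_mul_assoc, Finset.sum_mul, Finset.sum_congr rfl fun h _ => hs h, Finset.sum_const,
    Finset.card_univ, ← Nat.cast_smul_eq_nsmul ℚ, smul_smul, inv_mul_cancel₀, one_smul]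
  exact_mod_cast Fintype.card_ne_zero

lemma subIdem_orth {G : Type} [Group G] [Fintype G] (H K : Subgroup G) (ψ : H →* ℚ) (φ : K →* ℚ)
    (g : G) (h1 : g ∈ H) (h2 : g ∈ K) (hne : ψ ⟨g, h1⟩ ≠ φ ⟨g, h2⟩) :
    subIdem H ψ * subIdem K φ = 0 := by
  have e1 := subIdem_mul_single H ψ ⟨g, h1⟩
  have e2 := single_mul_subIdem K φ ⟨g, h2⟩
  have : ψ ⟨g, h1⟩ • (subIdem H ψ * subIdem K φ) = φ ⟨g, h2⟩ • (subIdem H ψ * subIdem K φ) := by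
    rw [← smul_mul_assoc, ← e1, mul_assoc, e2, mul_smul_comm]
  rw [← sub_eq_zero, ← sub_smul] at this
  exact (smul_eq_zero.1 this).resolve_left (sub_ne_zero.2 hne)

open CategoryTheory in
lemma no_fixed {G : Type} [Group G] (V : FDRep ℚ G) (hV : Simple V)
    (hdim : Module.finrank ℚ V = 7) (v : V) (hv : ∀ g, V.ρ g v = v) : v = 0 := by
  by_contra hne
  let W : FDRep ℚ G := FDRep.of (Representation.trivial ℚ G ℚ)
  let f : W ⟶ V := ⟨InducedCategory.homMk (ModuleCat.ofHom (LinearMap.toSpanSingleton ℚ V v)),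
    fun g => by
      apply InducedCategory.hom_ext
      apply ModuleCat.hom_ext
      apply LinearMap.ext
      intro (r : ℚ)
      change LinearMap.toSpanSingleton ℚ V v r = V.ρ g (LinearMap.toSpanSingleton ℚ V v r)
      simp [hv]⟩
  have hf : ∀ r : ℚ, (f.hom.hom.hom : ℚ →ₗ[ℚ] V) r = r • v := fun r => rfl
  have hm : Mono f := by
    apply ConcreteCategory.mono_of_injective
    intro a b hab
    have h2 : (a : ℚ) • v = (b : ℚ) • v := hab
    exact smul_left_injective ℚ hne h2
  have hn : f ≠ 0 := by
    intro h0
    have h1 := hf 1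
    rw [h0, one_smul] at h1
    exact hne h1.symm
  have hi : IsIso f := (Simple.mono_isIso_iff_nonzero f).2 hn
  have := (FDRep.isoToLinearEquiv (asIso f)).finrank_eq
  rw [hdim] at this
  have h1 : Module.finrank ℚ W = 1 := Module.finrank_self ℚ
  omega

/-- the subspace fixed by the elements with code in `L` -/
def fixL {G : Subgroup (Equiv.Perm (Fin 9))} (V : FDRep ℚ G) (L : List ℕ) : Submodule ℚ V where
  carrier := {v | ∀ g : G, enc g ∈ L → V.ρ g v = v}
  zero_mem' := fun g _ => map_zero _
  add_mem' := fun ha hb g hg => by rw [map_add, ha g hg, hb g hg]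
  smul_mem' := fun r v hv g hg => by rw [map_smul, hv g hg]

lemma fixL_mono {G : Subgroup (Equiv.Perm (Fin 9))} (V : FDRep ℚ G) {L M : List ℕ} (h : L ⊆ M) :
    fixL V M ≤ fixL V L := fun _ hv g hg => hv g (h hg)

/-- the subgroup with codes in `L` -/
def subL (G : Subgroup (Equiv.Perm (Fin 9))) (L : List ℕ) (h1 : idc ∈ L)
    (h2 : ∀ a ∈ L, ∀ b ∈ L, mulc a b ∈ L) : Subgroup G where
  carrier := {g | enc g ∈ L}
  one_mem' := by
    show enc 1 ∈ L
    rw [enc_one]; exact h1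
  mul_mem' := by
    intro a b ha hb
    show enc (a * b : G) ∈ L
    rw [Subgroup.coe_mul, enc_mul]
    exact h2 _ ha _ hb
  inv_mem' := by
    intro a ha
    have hp : ∀ n : ℕ, enc (a ^ n : G) ∈ L := by
      intro n
      induction n with
      | zero => rw [pow_zero, Subgroup.coe_one, enc_one]; exact h1
      | succ n ih =>
        rw [pow_succ, Subgroup.coe_mul, enc_mul]
        exact h2 _ ih _ ha
    show enc (a⁻¹ : G) ∈ L
    have hc : a⁻¹ = a ^ (Nat.card G - 1) := by
      refine inv_eq_of_mul_eq_one_right ?_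
      rw [← pow_succ', Nat.sub_add_cancel Nat.card_pos, pow_card_eq_one']
    rw [hc]
    exact hp _

lemma sum_codes {G : Subgroup (Equiv.Perm (Fin 9))} (hG : IsG G) (L : List ℕ) (hn : L.Nodup)
    (hL : ∀ a ∈ L, a ∈ allG) (F : ℕ → ℚ) (s : Finset G) (hs : ∀ g, g ∈ s ↔ enc g ∈ L) :
    ∑ g ∈ s, F (enc g) = (L.map F).sum := by
  rw [← List.sum_toFinset F hn]
  refine Finset.sum_bij (fun g _ => enc g) ?_ ?_ ?_ ?_
  · intro g hg
    simpa using (hs g).1 hg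
  · intro a _ b _ h
    exact Subtype.ext (enc_inj h)
  · intro a ha
    rw [List.mem_toFinset] at ha
    obtain ⟨g, rfl⟩ := hG.2 a (hL a ha)
    exact ⟨g, (hs g).2 ha, rfl⟩
  · intro g _
    rfl

lemma list_sum_count (T : ℕ → ℚ) (l : List ℕ) (hl : ∀ k ∈ l, k < 5) :
    (l.map T).sum = l.count 0 * T 0 + l.count 1 * T 1 + l.count 2 * T 2 + l.count 3 * T 3 +
      l.count 4 * T 4 := by
  induction l with
  | nil => simp
  | cons k l ih =>
    have hk := hl k (by simp)
    rw [List.map_cons, List.sum_cons, ih fun k hk => hl k (by simp [hk])]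
    interval_cases k <;> simp <;> ring

lemma cls_lt (a : ℕ) : cls a < 5 := by
  unfold cls
  split_ifs <;> norm_num

/-- the symmetrised character is a function of the class -/
lemma char_sym {G : Subgroup (Equiv.Perm (Fin 9))} (hG : IsG G) (V : FDRep ℚ G) :
    ∃ T : ℕ → ℚ, T 0 = V.character 1 ∧
      ∀ g : G, V.character g + V.character g⁻¹ = 2 * T (cls (enc g)) := by
  have hrep : ∀ k < 5, repL.getD k 0 ∈ allG := by decide +kernel
  have h1 : ∀ k : ℕ, ∃ r : G, k < 5 → enc r = repL.getD k 0 := by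
    intro k
    by_cases hk : k < 5
    · obtain ⟨r, hr⟩ := hG.2 _ (hrep k hk)
      exact ⟨r, fun _ => hr⟩
    · exact ⟨1, fun h => absurd h hk⟩
  choose r hr using h1
  refine ⟨fun k => (V.character (r k) + V.character (r k)⁻¹) / 2, ?_, ?_⟩
  · have : r 0 = 1 := by
      refine Subtype.ext (enc_inj ?_)
      rw [hr 0 (by norm_num), Subgroup.coe_one, enc_one]
      rfl
    simp only [this, inv_one]
    ring
  · intro g
    have hc := chk_cls
    simp only [List.all_eq_true, List.any_eq_true, Bool.or_eq_true, beq_iff_eq] at hc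
    obtain ⟨a, ha, h⟩ := hc _ (hG.1 g)
    obtain ⟨u, rfl⟩ := hG.2 a ha
    rw [← hr _ (cls_lt _)] at h
    set R := r (cls (enc g))
    rcases h with h | h
    · have : u * g = R * u := by
        refine Subtype.ext (enc_inj ?_)
        rw [Subgroup.coe_mul, enc_mul, Subgroup.coe_mul, enc_mul]; exact h
      have e : R = u * g * u⁻¹ := by rw [this]; group
      have e' : R⁻¹ = u * g⁻¹ * u⁻¹ := by rw [e]; group
      change V.character g + V.character g⁻¹ = 2 * ((V.character R + V.character R⁻¹) / 2)
      rw [e', e, FDRep.char_conj, FDRep.char_conj]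
      ring
    · have : R * (u * g) = u := by
        refine Subtype.ext (enc_inj ?_)
        rw [Subgroup.coe_mul, enc_mul, Subgroup.coe_mul, enc_mul]; exact h
      have e : R = u * g⁻¹ * u⁻¹ := by
        rw [mul_assoc, ← mul_inv_rev, eq_comm, mul_inv_eq_iff_eq_mul] 
        exact this.symm
      have e' : R⁻¹ = u * g * u⁻¹ := by rw [e]; group
      change V.character g + V.character g⁻¹ = 2 * ((V.character R + V.character R⁻¹) / 2)
      rw [e', e, FDRep.char_conj, FDRep.char_conj]
      ring

lemma sum_sub {G : Subgroup (Equiv.Perm (Fin 9))} (hG : IsG G) (V : FDRep ℚ G) (T : ℕ → ℚ)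
    (hT : ∀ g : G, V.character g + V.character g⁻¹ = 2 * T (cls (enc g)))
    (L : List ℕ) (hn : L.Nodup) (hL : isSub L = true) :
    (L.map fun a => T (cls a)).sum = L.length * Module.finrank ℚ (fixL V L) := by
  unfold isSub at hL
  simp only [List.all_eq_true, Bool.and_eq_true, List.contains_iff_mem] at hL
  obtain ⟨h1, h2⟩ := hL
  set H : Subgroup G := subL G L h1 (fun a ha => (h2 a ha).2) with hH
  have mH : ∀ g : G, g ∈ H ↔ enc g ∈ L := fun g => Iff.rfl
  have hs := sum_codes hG L hn (fun a ha => (h2 a ha).1)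
  have hsum : ∀ F : ℕ → ℚ, ∑ h : H, F (enc (h : G)) = (L.map F).sum := by
    intro F
    rw [← hs F (Finset.univ.filter fun g => g ∈ H) (by simp [mH]),
      Finset.sum_subtype (p := fun g => g ∈ H) _ (by simp)]
  have hcard : (Nat.card H : ℚ) = L.length := by
    have := hsum (fun _ => 1)
    simpa using this
  have : Invertible (Nat.card H : ℚ) := invertibleOfNonzero (by simp)
  have key := Representation.card_inv_mul_sum_char_eq_finrank
    ((V.ρ.comp H.subtype : H →* _) : Representation ℚ H V)
  have hfix : Representation.invariants ((V.ρ.comp H.subtype : H →* _) : Representation ℚ H V)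
      = fixL V L := by
    ext v
    constructor
    · intro hv g hg
      exact hv ⟨g, hg⟩
    · intro hv g
      exact hv g g.2
  rw [hfix] at key
  have h3 : ∑ h : H, V.character (h : G) = (L.map fun a => T (cls a)).sum := by
    have e2 : ∑ h : H, V.character ((h : G)⁻¹) = ∑ h : H, V.character (h : G) :=
      Fintype.sum_equiv (Equiv.inv H) _ _ (fun h => by simp)
    have e3 : ∑ h : H, (V.character (h : G) + V.character ((h : G)⁻¹)) =
        2 * ∑ h : H, T (cls (enc (h : G))) := by
      rw [Finset.mul_sum]
      exact Finset.sum_congr rfl fun h _ => hT h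
    rw [Finset.sum_add_distrib, e2, hsum fun a => T (cls a)] at e3
    linarith
  rw [← h3, ← hcard, ← key, mul_inv_cancel_left₀ (by simp)]
  rfl

lemma num_core (T : ℕ → ℚ) (h0 : T 0 = 7) (n s a u r f t : ℕ)
    (e1 : T 0 + 2 * T 2 = 3 * n) (e2 : T 0 + 3 * T 1 + 2 * T 2 = 6 * s)
    (e3 : T 0 + 3 * T 1 + 8 * T 2 = 12 * a)
    (e4 : T 0 + 9 * T 1 + 8 * T 2 + 6 * T 3 = 24 * u)
    (e5 : T 0 + T 1 + 2 * T 3 = 4 * r) (e6 : T 0 + 6 * T 4 = 7 * f)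
    (e7 : T 0 + 14 * T 2 + 6 * T 4 = 21 * t)
    (e8 : T 0 + 21 * T 1 + 56 * T 2 + 42 * T 3 + 48 * T 4 = 0)
    (i1 : s ≤ n) (i2 : a + s ≤ n + u) : ∀ k < 5, T k = tval k := by
  rw [h0] at e1 e2 e3 e4 e5 e6 e7 e8
  have q1 : 2 * s + 3 * n = 4 * a + 7 := by
    have : (2 * s + 3 * n : ℚ) = 4 * a + 7 := by linarith
    exact_mod_cast this
  have q2 : 2 * s + n + 2 * r = 7 + 4 * u := by
    have : (2 * s + n + 2 * r : ℚ) = 7 + 4 * u := by linarith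
    exact_mod_cast this
  have q3 : 3 * n + f = 3 * t + 7 := by
    have : (3 * n + f : ℚ) = 3 * t + 7 := by linarith
    exact_mod_cast this
  have q4 : 3 * n + 3 * r + 2 * f = 14 := by
    have : (3 * n + 3 * r + 2 * f : ℚ) = 14 := by linarith
    exact_mod_cast this
  have hn : n = 3 := by omega
  have hs : s = 1 := by omega
  have hr : r = 1 := by omega
  have hf : f = 1 := by omega
  subst hn hs hr hf
  push_cast at *
  intro k hk
  interval_cases k <;> simp [tval] <;> linarith

lemma fix_ineq {G : Subgroup (Equiv.Perm (Fin 9))} (hG : IsG G) (V : FDRep ℚ G) :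
    Module.finrank ℚ (fixL V spL) + Module.finrank ℚ (fixL V S3L) ≤
      Module.finrank ℚ (fixL V C3L) + Module.finrank ℚ (fixL V (spL ++ smL)) := by
  rw [← Submodule.finrank_sup_add_finrank_inf_eq]
  refine add_le_add (Submodule.finrank_mono ?_) (Submodule.finrank_mono ?_)
  · exact sup_le (fixL_mono V (by decide +kernel)) (fixL_mono V (by decide +kernel))
  · rintro v ⟨h1, h2⟩ g hg
    have hc := chk_gen
    simp only [List.all_eq_true, List.any_eq_true, beq_iff_eq] at hc
    obtain ⟨b, hb, d, hd, e⟩ := hc _ hg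
    have s1 : ∀ b ∈ spL, b ∈ allG := by decide +kernel
    have s2 : ∀ b ∈ S3L, b ∈ allG := by decide +kernel
    obtain ⟨b, rfl⟩ := hG.2 b (s1 b hb)
    obtain ⟨d, rfl⟩ := hG.2 d (s2 d hd)
    have : g = b * d := by
      refine Subtype.ext (enc_inj ?_)
      rw [Subgroup.coe_mul, enc_mul]; exact e
    rw [this, map_mul, Module.End.mul_apply, h2 d hd, h1 b hb]

lemma sum_cls (T : ℕ → ℚ) (L : List ℕ) :
    (L.map fun a => T (cls a)).sum = (L.map cls).count 0 * T 0 + (L.map cls).count 1 * T 1 +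
      (L.map cls).count 2 * T 2 + (L.map cls).count 3 * T 3 + (L.map cls).count 4 * T 4 := by
  rw [← list_sum_count T (L.map cls) (by simp [cls_lt]), List.map_map]
  rfl

lemma sum_univ {G : Subgroup (Equiv.Perm (Fin 9))} (hG : IsG G) (F : ℕ → ℚ) :
    ∑ g : G, F (enc g) = (allG.map F).sum :=
  sum_codes hG allG chk_nodup (fun _ h => h) F Finset.univ (fun g => by simp [hG.1 g])

lemma cnt_all : ((allG.map cls).count 0, (allG.map cls).count 1, (allG.map cls).count 2,
    (allG.map cls).count 3, (allG.map cls).count 4) = (1, 21, 56, 42, 48) := by decide +kernel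

lemma sum_univ_cls {G : Subgroup (Equiv.Perm (Fin 9))} (hG : IsG G) (F : ℕ → ℚ) :
    ∑ g : G, F (cls (enc g)) = F 0 + 21 * F 1 + 56 * F 2 + 42 * F 3 + 48 * F 4 := by
  rw [sum_univ hG fun a => F (cls a), sum_cls]
  have := cnt_all
  simp only [Prod.mk.injEq] at this
  obtain ⟨c0, c1, c2, c3, c4⟩ := this
  rw [c0, c1, c2, c3, c4]
  push_cast
  ring

lemma card_G {G : Subgroup (Equiv.Perm (Fin 9))} (hG : IsG G) : Nat.card G = 168 := by
  have := sum_univ_cls hG fun _ => 1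
  norm_num at this
  rw [Nat.card_eq_fintype_card]
  exact_mod_cast this

lemma T_eq {G : Subgroup (Equiv.Perm (Fin 9))} (hG : IsG G) (V : FDRep ℚ G)
    (hV : CategoryTheory.Simple V) (hdim : Module.finrank ℚ V = 7) (T : ℕ → ℚ)
    (hT0 : T 0 = V.character 1)
    (hT : ∀ g : G, V.character g + V.character g⁻¹ = 2 * T (cls (enc g))) :
    ∀ k < 5, T k = tval k := by
  have h7 : T 0 = 7 := by rw [hT0, FDRep.char_one, hdim]; norm_num
  have key : ∀ (L : List ℕ) (c0 c1 c2 c3 c4 m : ℕ), L.Nodup → isSub L = true →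
      ((L.map cls).count 0, (L.map cls).count 1, (L.map cls).count 2,
        (L.map cls).count 3, (L.map cls).count 4, L.length) = (c0, c1, c2, c3, c4, m) →
      c0 * T 0 + c1 * T 1 + c2 * T 2 + c3 * T 3 + c4 * T 4 =
        m * Module.finrank ℚ (fixL V L) := by
    intro L c0 c1 c2 c3 c4 m hn hs hc
    simp only [Prod.mk.injEq] at hc
    obtain ⟨rfl, rfl, rfl, rfl, rfl, rfl⟩ := hc
    rw [← sum_sub hG V T hT L hn hs, sum_cls]
  have e1 := key C3L 1 0 2 0 0 3 (by decide +kernel) chk_C3 (by decide +kernel)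
  have e2 := key S3L 1 3 2 0 0 6 (by decide +kernel) chk_S3 (by decide +kernel)
  have e3 := key spL 1 3 8 0 0 12 (by decide +kernel) chk_A4 (by decide +kernel)
  have e4 := key (spL ++ smL) 1 9 8 6 0 24 (by decide +kernel) chk_S4 (by decide +kernel)
  have e5 := key C4L 1 1 0 2 0 4 (by decide +kernel) chk_C4 (by decide +kernel)
  have e6 := key C7L 1 0 0 0 6 7 (by decide +kernel) chk_C7 (by decide +kernel)
  have e7 := key F21L 1 0 14 0 6 21 (by decide +kernel) chk_F21 (by decide +kernel)
  have i1 : Module.finrank ℚ (fixL V S3L) ≤ Module.finrank ℚ (fixL V C3L) :=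
    Submodule.finrank_mono (fixL_mono V (by decide +kernel))
  have i2 := fix_ineq hG V
  have e8 : T 0 + 21 * T 1 + 56 * T 2 + 42 * T 3 + 48 * T 4 = 0 := by
    rw [← sum_univ_cls hG]
    have : Invertible (Nat.card G : ℚ) := invertibleOfNonzero (by simp)
    have k := Representation.card_inv_mul_sum_char_eq_finrank V.ρ
    have hb : Representation.invariants V.ρ = ⊥ := by
      rw [eq_bot_iff]
      intro v hv
      exact no_fixed V hV hdim v hv
    rw [hb, finrank_bot, card_G hG] at k
    have k' : ∑ g : G, V.character g = 0 := by
      have k2 : ((168 : ℕ) : ℚ)⁻¹ * ∑ g : G, V.character g = ((0 : ℕ) : ℚ) := k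
      simpa using k2
    have e2 : ∑ g : G, V.character g⁻¹ = ∑ g : G, V.character g :=
      Fintype.sum_equiv (Equiv.inv G) _ _ (fun h => by simp)
    have e3 : ∑ g : G, (V.character g + V.character g⁻¹) =
        2 * ∑ g : G, T (cls (enc g)) := by
      rw [Finset.mul_sum]
      exact Finset.sum_congr rfl fun h _ => hT h
    rw [Finset.sum_add_distrib, e2, k'] at e3
    linarith
  push_cast at e1 e2 e3 e4 e5 e6 e7
  generalize Module.finrank ℚ (fixL V C3L) = n at *
  generalize Module.finrank ℚ (fixL V S3L) = s at *
  generalize Module.finrank ℚ (fixL V spL) = a at *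
  generalize Module.finrank ℚ (fixL V (spL ++ smL)) = u at *
  generalize Module.finrank ℚ (fixL V C4L) = r at *
  generalize Module.finrank ℚ (fixL V C7L) = f at *
  generalize Module.finrank ℚ (fixL V F21L) = t at *
  exact num_core T h7 n s a u r f t (by linarith) (by linarith) (by linarith) (by linarith)
    (by linarith) (by linarith) (by linarith) e8 i1 i2

open CategoryTheory in
lemma char_eq {G : Subgroup (Equiv.Perm (Fin 9))} (hG : IsG G) (V : FDRep ℚ G)
    (hV : Simple V) (hdim : Module.finrank ℚ V = 7) (g : G) :
    V.character g = tval (cls (enc g)) := by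
  obtain ⟨T, hT0, hT⟩ := char_sym hG V
  have hk := T_eq hG V hV hdim T hT0 hT
  have : Invertible (Nat.card G : ℚ) := invertibleOfNonzero (by simp)
  have key := FDRep.scalar_product_char_eq_finrank_equivariant V V
  have h1 : 1 ≤ Module.finrank ℚ (V ⟶ V) := by
    have : Nontrivial (V ⟶ V) := ⟨𝟙 V, 0, id_nonzero V⟩
    exact Module.finrank_pos
  have h2 : (168 : ℚ) ≤ ∑ g : G, V.character g * V.character g⁻¹ := by
    have h1' : (1 : ℚ) ≤ Module.finrank ℚ (V ⟶ V) := by exact_mod_cast h1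
    rw [← key, card_G hG] at h1'
    push_cast at h1'
    linarith
  have h3 : ∑ g : G, T (cls (enc g)) ^ 2 = 168 := by
    rw [sum_univ_cls hG fun k => T k ^ 2]
    simp only [hk 0 (by norm_num), hk 1 (by norm_num), hk 2 (by norm_num), hk 3 (by norm_num),
      hk 4 (by norm_num)]
    norm_num [tval]
  have h4 : ∀ g : G, T (cls (enc g)) ^ 2 - V.character g * V.character g⁻¹ =
      ((V.character g - V.character g⁻¹) / 2) ^ 2 := by
    intro g
    have : T (cls (enc g)) = (V.character g + V.character g⁻¹) / 2 := by
      rw [hT g]; ring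
    rw [this]
    ring
  have h5 : ∑ g : G, ((V.character g - V.character g⁻¹) / 2) ^ 2 = 0 := by
    refine le_antisymm ?_ (Finset.sum_nonneg fun g _ => sq_nonneg _)
    rw [← Finset.sum_congr rfl fun g _ => h4 g, Finset.sum_sub_distrib, h3]
    linarith
  have h6 := (Finset.sum_eq_zero_iff_of_nonneg fun g _ => sq_nonneg _).1 h5 g (Finset.mem_univ g)
  have h7 := pow_eq_zero_iff (two_ne_zero) |>.1 h6
  have h8 := hT g
  rw [hk _ (cls_lt _)] at h8
  linarith

lemma subIdem_apply {G : Subgroup (Equiv.Perm (Fin 9))} (H : Subgroup G)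
    (hc : Fintype.card H = 24) (ψ : H → ℚ) (f : G → ℚ) (h1 : ∀ g : G, g ∈ H ↔ f g ≠ 0)
    (h2 : ∀ h : H, ψ h = f h) :
    subIdem H ψ = (24 : ℚ)⁻¹ • ∑ g : G, MonoidAlgebra.single g (f g⁻¹) := by
  unfold subIdem
  rw [hc]
  congr 1
  have : ∑ g ∈ Finset.univ.filter (fun g => g ∈ H), MonoidAlgebra.single g (f g⁻¹) =
      ∑ h : H, MonoidAlgebra.single (h : G) (ψ h⁻¹) := by
    rw [Finset.sum_subtype (p := fun g => g ∈ H) _ (by simp)]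
    refine Finset.sum_congr rfl fun h _ => ?_
    rw [h2]
    rfl
  rw [← this]
  refine Finset.sum_subset (Finset.subset_univ _) fun g _ hg => ?_
  have hg' : ¬ g⁻¹ ∈ H := by simpa using hg
  rw [h1, not_not] at hg'
  rw [hg', MonoidAlgebra.single_zero]

lemma coeff_sum {G : Type} (g : G) (f : ℕ → ℤ) :
    (MonoidAlgebra.single g ((((List.range 7).map f).sum : ℤ) : ℚ) : MonoidAlgebra ℚ G) =
      ∑ j : Fin 7, MonoidAlgebra.single g (f j : ℚ) := by
  rw [Fin.sum_univ_seven]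
  simp only [← MonoidAlgebra.single_add]
  congr 1
  simp [List.range_succ]
  ring

theorem stmt3
    (G : Subgroup (Equiv.Perm (Fin 9)))
    (hG : G = Subgroup.closure
      {c[(3 : Fin 9), 6, 7] * c[(4 : Fin 9), 5, 8], c[(1 : Fin 9), 8, 2] * c[(4 : Fin 9), 5, 6]})
    (x y : G)
    (hx : (x : Equiv.Perm (Fin 9)) = c[(2 : Fin 9), 6, 4] * c[(3 : Fin 9), 5, 8])
    (hy : (y : Equiv.Perm (Fin 9)) =
      c[(1 : Fin 9), 5] * c[(2 : Fin 9), 8] * c[(3 : Fin 9), 6] * c[(4 : Fin 9), 7])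
    -- S 0, …, S 6 : the seven conjugates in G of S₄,(1) = ⟨x, y⟩
    (S : Fin 7 → Subgroup G)
    (hS0 : S 0 = Subgroup.closure {x, y})
    (hSconj : ∀ i, ∃ g : G, S i = conjSub g (S 0))
    (hSinj : Function.Injective S)
    (hScompl : ∀ T : Subgroup G, (∃ g : G, T = conjSub g (S 0)) → ∃ i, T = S i)
    -- each S i is isomorphic to the symmetric group of degree 4
    (hSiso : ∀ i, Nonempty ((S i : Subgroup G) ≃* Equiv.Perm (Fin 4)))
    -- η i : the unique non-trivial degree-1 (sign) character of S i
    (η : ∀ i, (S i : Subgroup G) →* ℚ)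
    (hη : ∀ i, η i ≠ 1)
    -- the irreducible character χ₅^G of degree 7
    (V : FDRep ℚ G) (hV : CategoryTheory.Simple V) (hdim : Module.finrank ℚ V = 7) :
    cenIdem V.character 7 = ∑ i, subIdem (S i) (η i) ∧
    ∀ i j, subIdem (S i) (η i) * subIdem (S j) (η j) =
      if i = j then subIdem (S i) (η i) else 0 := by
  have hI : IsG G := isG_of hG (by rw [hx]; exact enc_x) (by rw [hy]; exact enc_y)
  have hx' : enc x = 14839600656 := by rw [hx]; exact enc_x
  have hy' : enc y = 9715542096 := by rw [hy]; exact enc_y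
  obtain ⟨p, hp⟩ := exists_pi hI hx' hy' S hS0 hScompl η hη
  constructor
  · have hc : ∀ i, Fintype.card (S i) = 24 := by
      intro i
      obtain ⟨e⟩ := hSiso i
      rw [← Nat.card_eq_fintype_card, Nat.card_congr e.toEquiv, Nat.card_perm, Nat.card_fin]
      rfl
    have hf : ∀ j, subIdem (S (p j)) (η (p j)) = (24 : ℚ)⁻¹ • ∑ g : G,
        MonoidAlgebra.single g ((sgn0 (cj j (enc (g⁻¹ : G))) : ℤ) : ℚ) := by
      intro j
      exact subIdem_apply (S (p j)) (hc _) (η (p j)) (fun g => ((sgn0 (cj j (enc g)) : ℤ) : ℚ))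
        (fun g => by rw [(hp j).1 g, ne_eq, ne_eq, Int.cast_eq_zero]) (hp j).2
    rw [← Equiv.sum_comp p, Finset.sum_congr rfl fun j _ => hf j, ← Finset.smul_sum,
      Finset.sum_comm, cenIdem]
    have hcard : Fintype.card G = 168 := by rw [← Nat.card_eq_fintype_card, card_G hI]
    have hq : (7 : ℚ) / ((168 : ℕ) : ℚ) = 24⁻¹ := by norm_num
    rw [hcard, hq]
    refine congrArg (fun z => (24 : ℚ)⁻¹ • z) ?_
    refine Finset.sum_congr rfl fun g _ => ?_
    rw [char_eq hI V hV hdim]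
    have h1 := chk_char
    simp only [List.all_eq_true, beq_iff_eq] at h1
    rw [← h1 _ (hI.1 g⁻¹)]
    generalize enc (g⁻¹ : G) = a
    exact coeff_sum g fun j => sgn0 (cj j a)
  · intro i j
    by_cases hij : i = j
    · subst hij
      rw [if_pos rfl]
      exact subIdem_idem _ _
    · rw [if_neg hij]
      obtain ⟨i, rfl⟩ := p.surjective i
      obtain ⟨j, rfl⟩ := p.surjective j
      have ho := chk_orth
      simp only [List.all_eq_true, List.mem_range, Bool.or_eq_true, beq_iff_eq,
        List.any_eq_true] at ho
      rcases ho i i.2 j j.2 with h | ⟨a, ha, h⟩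
      · exact absurd (congrArg p (Fin.ext h)) hij
      obtain ⟨g, rfl⟩ := hI.2 a ha
      have m1 : g ∈ S (p i) := by
        rw [(hp i).1]
        intro h0
        rw [h0, zero_mul] at h
        norm_num at h
      have m2 : g ∈ S (p j) := by
        rw [(hp j).1]
        intro h0
        rw [h0, mul_zero] at h
        norm_num at h
      refine subIdem_orth _ _ _ _ g m1 m2 ?_
      rw [(hp i).2, (hp j).2]
      intro he
      have he' := Int.cast_injective he
      dsimp only at he'
      rw [he'] at h
      generalize sgn0 (cj j (enc g)) = z at h
      nlinarith [mul_self_nonneg z]
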